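/- Strong duality (Lemma 3.1): For every ρ ∈ ℝ^L with 0 ≤ ρ_p ≤ 1 for all p, the optimal value E_sdp[ρ] of the primal 2-marginal SDP is finite and equals the supremum of the dual 2-marginal SDP objective over all dual-feasible points; i.e., the duality gap between the primal and dual 2-marginal SDPs is zero. -/

import Mathlib

open Matrix BigOperators

noncomputable section

abbrev Idx (L : ℕ) := Fin L × Fin 2

/-- The fixed 1-marginal `μ_p^(1) = (1 - ρ_p, ρ_p)ᵀ`. -/
def mu1 {L : ℕ} (ρ : Fin L → ℝ) (p : Fin L) (t : Fin 2) : ℝ :=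
  if t = 0 then 1 - ρ p else ρ p

/-- Feasibility for the primal 2-marginal SDP. -/
def PrimalFeasible {L : ℕ} (ρ : Fin L → ℝ) (M : Matrix (Idx L) (Idx L) ℝ) : Prop :=
  M.PosSemidef ∧
  (∀ p q : Fin L, p ≠ q → ∀ t u : Fin 2, 0 ≤ M (p, t) (q, u)) ∧
  (∀ p q : Fin L, p ≠ q → ∀ t : Fin 2, ∑ u : Fin 2, M (p, t) (q, u) = mu1 ρ p t) ∧
  (∀ p : Fin L, ∀ t u : Fin 2, M (p, t) (p, u) = if t = u then mu1 ρ p t else 0)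

/-- Feasibility for the dual 2-marginal SDP. -/
def DualFeasible {L : ℕ} (C Y : Matrix (Idx L) (Idx L) ℝ)
    (φ ψ : Fin L → Fin L → Fin 2 → ℝ) : Prop :=
  Y.PosSemidef ∧
  ∀ p q : Fin L, p < q → ∀ t u : Fin 2,
    φ p q t + ψ p q u ≤ C (p, t) (q, u) - Y (p, t) (q, u)

/-- The dual objective `F(Y, {φ_pq, ψ_pq})`. -/
def dualObj {L : ℕ} (ρ : Fin L → ℝ) (Y : Matrix (Idx L) (Idx L) ℝ)
    (φ ψ : Fin L → Fin L → Fin 2 → ℝ) : ℝ :=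
  2 * ∑ p : Fin L, ∑ q : Fin L,
      (if p < q then
        (∑ t : Fin 2, φ p q t * mu1 ρ p t) + (∑ u : Fin 2, ψ p q u * mu1 ρ q u)
       else 0)
    - ∑ p : Fin L, ∑ t : Fin 2, Y (p, t) (p, t) * mu1 ρ p t

/-- Set of objective values attained by primal feasible points. -/
def primalValues {L : ℕ} (ρ : Fin L → ℝ) (C : Matrix (Idx L) (Idx L) ℝ) : Set ℝ :=
  {x | ∃ M : Matrix (Idx L) (Idx L) ℝ, PrimalFeasible ρ M ∧ x = Matrix.trace (C * M)}

/-- Set of objective values attained by dual feasible points. -/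
def dualValues {L : ℕ} (ρ : Fin L → ℝ) (C : Matrix (Idx L) (Idx L) ℝ) : Set ℝ :=
  {x | ∃ Y φ ψ, DualFeasible C Y φ ψ ∧ x = dualObj ρ Y φ ψ}

/-- A double sum of a symmetric family is its diagonal plus twice its strict upper triangle. -/
theorem sum_sum_eq_diag_add_two_mul_upper {ι : Type*} [Fintype ι] [LinearOrder ι]
    (f : ι → ι → ℝ) (hf : ∀ p q, f p q = f q p) :
    ∑ p, ∑ q, f p q = (∑ p, f p p) + 2 * ∑ p, ∑ q, if p < q then f p q else 0 := by
  have hsplit : ∀ p q, f p q =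
      (if p < q then f p q else 0) + (if q < p then f q p else 0) +
        (if p = q then f p q else 0) := by
    intro p q
    rcases lt_trichotomy p q with h | h | h
    · simp [h, h.not_gt, h.ne]
    · simp [h]
    · simp [h, h.not_gt, h.ne', hf p q]
  have hswap : ∑ p, ∑ q, (if q < p then f q p else 0) =
      ∑ p, ∑ q, if p < q then f p q else 0 := Finset.sum_comm
  calc ∑ p, ∑ q, f p q
      = ∑ p, ∑ q, ((if p < q then f p q else 0) + (if q < p then f q p else 0) +
        (if p = q then f p q else 0)) :=
        Finset.sum_congr rfl fun p _ => Finset.sum_congr rfl fun q _ => hsplit p q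
    _ = _ := by
        simp only [Finset.sum_add_distrib, hswap, Finset.sum_ite_eq, Finset.mem_univ, if_true]
        ring

/-- Optimal transport duality between two probability vectors on two points. -/
theorem exists_coupling_eq_dual_potentials (c : Fin 2 → Fin 2 → ℝ) (α β : Fin 2 → ℝ)
    (hα : ∀ t, 0 ≤ α t) (hβ : ∀ t, 0 ≤ β t) (hα1 : α 0 + α 1 = 1) (hβ1 : β 0 + β 1 = 1) :
    ∃ (m : Fin 2 → Fin 2 → ℝ) (φ ψ : Fin 2 → ℝ),
      (∀ t u, 0 ≤ m t u) ∧ (∀ t, ∑ u, m t u = α t) ∧ (∀ u, ∑ t, m t u = β u) ∧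
      (∀ t u, φ t + ψ u ≤ c t u) ∧
      ∑ t, ∑ u, c t u * m t u = (∑ t, φ t * α t) + ∑ u, ψ u * β u := by
  have a0 := hα 0
  have a1 := hα 1
  have b0 := hβ 0
  have b1 := hβ 1
  have hα0 : α 0 = 1 - α 1 := by linarith
  have hβ0 : β 0 = 1 - β 1 := by linarith
  rcases le_total (c 0 0 + c 1 1) (c 0 1 + c 1 0) with hc | hc
  · rcases le_total (α 1) (β 1) with h | h
    · refine ⟨![![β 0, β 1 - α 1], ![0, α 1]], ![c 0 0, c 1 1 - c 0 1 + c 0 0],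
        ![0, c 0 1 - c 0 0], ?_, ?_, ?_, ?_, ?_⟩ <;>
      simp [Fin.forall_fin_two, Fin.sum_univ_two]
      · exact ⟨⟨b0, h⟩, a1⟩
      · linarith
      · linarith
      · rw [hα0, hβ0]; ring
    · refine ⟨![![α 0, 0], ![α 1 - β 1, β 1]], ![c 0 0, c 1 0],
        ![0, c 1 1 - c 1 0], ?_, ?_, ?_, ?_, ?_⟩ <;>
      simp [Fin.forall_fin_two, Fin.sum_univ_two]
      · exact ⟨a0, h, b1⟩
      · linarith
      · linarith
      · rw [hα0]; ring
  · rcases le_total (α 0) (β 1) with h | h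
    · refine ⟨![![0, α 0], ![β 0, β 1 - α 0]], ![c 0 1, c 1 1],
        ![c 1 0 - c 1 1, 0], ?_, ?_, ?_, ?_, ?_⟩ <;>
      simp [Fin.forall_fin_two, Fin.sum_univ_two]
      · exact ⟨a0, b0, h⟩
      · linarith
      · linarith
      · rw [hα0, hβ0]; ring
    · refine ⟨![![α 0 - β 1, β 1], ![α 1, 0]], ![c 0 0, c 1 0],
        ![0, c 0 1 - c 0 0], ?_, ?_, ?_, ?_, ?_⟩ <;>
      simp [Fin.forall_fin_two, Fin.sum_univ_two]
      · exact ⟨⟨h, b1⟩, a1⟩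
      · linarith
      · linarith
      · rw [hα0]; ring

theorem trace_mul_nonneg_of_posSemidef {n : Type*} [Fintype n] [DecidableEq n]
    {A B : Matrix n n ℝ} (hA : A.PosSemidef) (hB : B.PosSemidef) : 0 ≤ (A * B).trace := by
  open scoped MatrixOrder in
  obtain ⟨D, rfl⟩ := CStarAlgebra.nonneg_iff_eq_star_mul_self.mp hB.nonneg
  rw [Matrix.star_eq_conjTranspose, ← Matrix.mul_assoc, Matrix.trace_mul_comm,
    ← Matrix.mul_assoc]
  exact (hA.mul_mul_conjTranspose_same D).trace_nonneg

theorem isClosed_setOf_posSemidef {n : Type*} [Fintype n] :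
    IsClosed {A : Matrix n n ℝ | A.PosSemidef} := by
  simp only [Matrix.posSemidef_iff_dotProduct_mulVec, Set.ofPred_and, Set.ofPred_forall]
  refine IsClosed.inter (isClosed_eq (by fun_prop) (by fun_prop)) (isClosed_iInter fun x => ?_)
  exact isClosed_le (by fun_prop) (by fun_prop)

/-- A linear functional that is nonnegative on the positive semidefinite cone is represented by a
positive semidefinite matrix through the trace pairing. -/
theorem exists_posSemidef_trace_mul_eq {n : Type*} [Fintype n] [DecidableEq n]
    (g : Matrix n n ℝ →ₗ[ℝ] ℝ) (hg : ∀ A : Matrix n n ℝ, A.PosSemidef → 0 ≤ g A) :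
    ∃ Y : Matrix n n ℝ, Y.PosSemidef ∧ ∀ A : Matrix n n ℝ, A.IsSymm → g A = (Y * A).trace := by
  have hrep : ∀ A : Matrix n n ℝ, g A = ∑ i, ∑ j, A i j * g (Matrix.single i j 1) := by
    intro A
    conv_lhs => rw [Matrix.matrix_eq_sum_single A]
    simp only [map_sum]
    refine Finset.sum_congr rfl fun i _ => Finset.sum_congr rfl fun j _ => ?_
    rw [← smul_eq_mul, ← map_smul, Matrix.smul_single, smul_eq_mul, mul_one]
  let Y : Matrix n n ℝ := Matrix.of fun i j =>
    (g (Matrix.single i j 1) + g (Matrix.single j i 1)) / 2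
  have htr : ∀ A : Matrix n n ℝ, A.IsSymm → g A = (Y * A).trace := by
    intro A hA
    have h1 : g A = ∑ i, ∑ j, A i j * g (Matrix.single j i 1) := by
      rw [hrep A, Finset.sum_comm]
      exact Finset.sum_congr rfl fun i _ => Finset.sum_congr rfl fun j _ => by rw [hA.apply]
    have h2 : (Y * A).trace = (g A + g A) / 2 := by
      conv_rhs => rw [h1]; arg 1; arg 1; rw [← h1, hrep A]
      simp only [Matrix.trace, Matrix.diag_apply, Matrix.mul_apply, Y, Matrix.of_apply,
        ← Finset.sum_add_distrib, Finset.sum_div]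
      refine Finset.sum_congr rfl fun i _ => Finset.sum_congr rfl fun j _ => ?_
      rw [hA.apply]; ring
    linarith
  refine ⟨Y, .of_dotProduct_mulVec_nonneg ?_ fun x => ?_, htr⟩
  · ext i j
    simp [Y, add_comm]
  · have h := hg _ (Matrix.posSemidef_vecMulVec_self_star x)
    rw [htr _ (by ext i j; simp [Matrix.vecMulVec_apply, mul_comm]), Matrix.mul_vecMulVec,
      Matrix.trace_vecMulVec, dotProduct_comm] at h
    exact h

theorem isSymm_of_posSemidef {n : Type*} {A : Matrix n n ℝ} (hA : A.PosSemidef) : A.IsSymm := by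
  simpa [Matrix.IsHermitian, Matrix.IsSymm, Matrix.conjTranspose_eq_transpose_of_trivial]
    using hA.1

/-- The linear constraints of the primal problem, together with symmetry. -/
def transportPlans {L : ℕ} (ρ : Fin L → ℝ) : Set (Matrix (Idx L) (Idx L) ℝ) :=
  {M | M.IsSymm ∧
    (∀ p q : Fin L, p ≠ q → ∀ t u : Fin 2, 0 ≤ M (p, t) (q, u)) ∧
    (∀ p q : Fin L, p ≠ q → ∀ t : Fin 2, ∑ u : Fin 2, M (p, t) (q, u) = mu1 ρ p t) ∧
    (∀ p : Fin L, ∀ t u : Fin 2, M (p, t) (p, u) = if t = u then mu1 ρ p t else 0)}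

theorem PrimalFeasible.mem_transportPlans {L : ℕ} {ρ : Fin L → ℝ}
    {M : Matrix (Idx L) (Idx L) ℝ} (hM : PrimalFeasible ρ M) : M ∈ transportPlans ρ :=
  ⟨isSymm_of_posSemidef hM.1, hM.2⟩

theorem mu1_nonneg {L : ℕ} {ρ : Fin L → ℝ} (hρ : ∀ p, 0 ≤ ρ p ∧ ρ p ≤ 1) (p : Fin L)
    (t : Fin 2) : 0 ≤ mu1 ρ p t := by
  unfold mu1
  split_ifs <;> linarith [hρ p]

theorem mu1_le_one {L : ℕ} {ρ : Fin L → ℝ} (hρ : ∀ p, 0 ≤ ρ p ∧ ρ p ≤ 1) (p : Fin L)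
    (t : Fin 2) : mu1 ρ p t ≤ 1 := by
  unfold mu1
  split_ifs <;> linarith [hρ p]

theorem sum_mu1 {L : ℕ} (ρ : Fin L → ℝ) (p : Fin L) : ∑ t, mu1 ρ p t = 1 := by
  simp [mu1, Fin.sum_univ_two]

theorem isClosed_transportPlans {L : ℕ} (ρ : Fin L → ℝ) : IsClosed (transportPlans ρ) := by
  simp only [transportPlans, Set.ofPred_and, Set.ofPred_forall]
  refine IsClosed.inter (isClosed_eq (by fun_prop) (by fun_prop))
    (IsClosed.inter ?_ (IsClosed.inter ?_ ?_))
  · exact isClosed_iInter fun p => isClosed_iInter fun q => isClosed_iInter fun _ =>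
      isClosed_iInter fun t => isClosed_iInter fun u => isClosed_le (by fun_prop) (by fun_prop)
  · exact isClosed_iInter fun p => isClosed_iInter fun q => isClosed_iInter fun _ =>
      isClosed_iInter fun t => isClosed_eq (by fun_prop) (by fun_prop)
  · exact isClosed_iInter fun p => isClosed_iInter fun t => isClosed_iInter fun u =>
      isClosed_eq (by fun_prop) (by fun_prop)

theorem isCompact_transportPlans {L : ℕ} {ρ : Fin L → ℝ} (hρ : ∀ p, 0 ≤ ρ p ∧ ρ p ≤ 1) :
    IsCompact (transportPlans ρ) := by
  have hbox : IsCompact (Set.pi Set.univ fun _ => Set.pi Set.univ fun _ => Set.Icc 0 1 :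
      Set (Idx L → Idx L → ℝ)) :=
    isCompact_univ_pi fun _ => isCompact_univ_pi fun _ => isCompact_Icc
  refine IsCompact.of_isClosed_subset hbox (isClosed_transportPlans ρ) ?_
  rintro M ⟨-, hpos, hrow, hdiag⟩ ⟨p, t⟩ - ⟨q, u⟩ -
  rcases eq_or_ne p q with rfl | hpq
  · rw [hdiag]
    split_ifs
    · exact ⟨mu1_nonneg hρ p t, mu1_le_one hρ p t⟩
    · simp
  · refine ⟨hpos p q hpq t u, le_trans ?_ (mu1_le_one hρ p t)⟩
    rw [← hrow p q hpq t]
    exact Finset.single_le_sum (f := fun u => M (p, t) (q, u))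
      (fun v _ => hpos p q hpq t v) (Finset.mem_univ u)

theorem convex_transportPlans {L : ℕ} (ρ : Fin L → ℝ) : Convex ℝ (transportPlans ρ) := by
  rintro M ⟨hs, hpos, hrow, hdiag⟩ N ⟨hs', hpos', hrow', hdiag'⟩ a b ha hb hab
  refine ⟨(hs.smul a).add (hs'.smul b), fun p q hpq t u => ?_, fun p q hpq t => ?_,
    fun p t u => ?_⟩
  · exact add_nonneg (mul_nonneg ha (hpos p q hpq t u)) (mul_nonneg hb (hpos' p q hpq t u))
  · simp only [Matrix.add_apply, Matrix.smul_apply, smul_eq_mul, Finset.sum_add_distrib,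
      ← Finset.mul_sum, hrow p q hpq, hrow' p q hpq, ← add_mul, hab, one_mul]
  · simp only [Matrix.add_apply, Matrix.smul_apply, smul_eq_mul, hdiag, hdiag', ← add_mul, hab,
      one_mul]

theorem col_sum_of_mem_transportPlans {L : ℕ} {ρ : Fin L → ℝ} {M : Matrix (Idx L) (Idx L) ℝ}
    (hM : M ∈ transportPlans ρ) {p q : Fin L} (hpq : p ≠ q) (u : Fin 2) :
    ∑ t, M (p, t) (q, u) = mu1 ρ q u := by
  rw [← hM.2.2.1 q p hpq.symm u]
  exact Finset.sum_congr rfl fun t _ => (hM.1.apply _ _).symm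

theorem trace_mul_of_mem_transportPlans {L : ℕ} {ρ : Fin L → ℝ}
    {W M : Matrix (Idx L) (Idx L) ℝ} (hW : W.IsSymm) (hM : M ∈ transportPlans ρ) :
    (W * M).trace = (∑ p, ∑ t, W (p, t) (p, t) * mu1 ρ p t) +
      2 * ∑ p, ∑ q, if p < q then ∑ t, ∑ u, W (p, t) (q, u) * M (p, t) (q, u) else 0 := by
  have h1 : (W * M).trace = ∑ p, ∑ q, ∑ t, ∑ u, W (p, t) (q, u) * M (p, t) (q, u) := by
    simp only [Matrix.trace, Matrix.diag_apply, Matrix.mul_apply, Fintype.sum_prod_type]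
    refine Finset.sum_congr rfl fun p _ => ?_
    rw [Finset.sum_comm]
    refine Finset.sum_congr rfl fun q _ => Finset.sum_congr rfl fun t _ =>
      Finset.sum_congr rfl fun u _ => ?_
    rw [hM.1.apply]
  rw [h1, sum_sum_eq_diag_add_two_mul_upper]
  · simp [hM.2.2.2]
  · intro p q
    rw [Finset.sum_comm]
    refine Finset.sum_congr rfl fun t _ => Finset.sum_congr rfl fun u _ => ?_
    rw [hM.1.apply, hW.apply]

/-- The Lagrangian `Tr((C - Y)M)` exceeds the dual objective by the total slack of the
potentials. -/
theorem trace_sub_mul_sub_dualObj {L : ℕ} {ρ : Fin L → ℝ} {C Y M : Matrix (Idx L) (Idx L) ℝ}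
    (hC : C.IsSymm) (hCdiag : ∀ p : Fin L, ∀ t u : Fin 2, C (p, t) (p, u) = 0)
    (hY : Y.IsSymm) (hM : M ∈ transportPlans ρ) (φ ψ : Fin L → Fin L → Fin 2 → ℝ) :
    ((C - Y) * M).trace - dualObj ρ Y φ ψ = 2 * ∑ p, ∑ q, if p < q then
      (∑ t, ∑ u, (C - Y) (p, t) (q, u) * M (p, t) (q, u)) -
        ((∑ t, φ p q t * mu1 ρ p t) + ∑ u, ψ p q u * mu1 ρ q u) else 0 := by
  have hsplit : ∀ (p q : Fin L) (a b : ℝ), (if p < q then a - b else 0) =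
      (if p < q then a else 0) - (if p < q then b else 0) := by
    intro p q a b
    split_ifs <;> simp
  rw [trace_mul_of_mem_transportPlans (hC.sub hY) hM, dualObj]
  simp only [hsplit, Finset.sum_sub_distrib]
  simp only [Matrix.sub_apply, hCdiag, zero_sub, neg_mul, Finset.sum_neg_distrib]
  ring

theorem dualObj_le_trace {L : ℕ} {ρ : Fin L → ℝ} {C Y M : Matrix (Idx L) (Idx L) ℝ}
    (hC : C.IsSymm) (hCdiag : ∀ p : Fin L, ∀ t u : Fin 2, C (p, t) (p, u) = 0)
    {φ ψ : Fin L → Fin L → Fin 2 → ℝ} (hD : DualFeasible C Y φ ψ) (hM : PrimalFeasible ρ M) :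
    dualObj ρ Y φ ψ ≤ (C * M).trace := by
  have hMX := hM.mem_transportPlans
  have hYM := trace_mul_nonneg_of_posSemidef hD.1 hM.1
  have hgap := trace_sub_mul_sub_dualObj hC hCdiag (isSymm_of_posSemidef hD.1) hMX φ ψ
  have hslack : 0 ≤ ∑ p, ∑ q, if p < q then
      (∑ t, ∑ u, (C - Y) (p, t) (q, u) * M (p, t) (q, u)) -
        ((∑ t, φ p q t * mu1 ρ p t) + ∑ u, ψ p q u * mu1 ρ q u) else 0 := by
    refine Finset.sum_nonneg fun p _ => Finset.sum_nonneg fun q _ => ?_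
    split_ifs with hpq
    · have hφ : ∑ t, φ p q t * mu1 ρ p t = ∑ t, ∑ u, φ p q t * M (p, t) (q, u) := by
        simp only [← Finset.mul_sum, hMX.2.2.1 p q hpq.ne]
      have hψ : ∑ u, ψ p q u * mu1 ρ q u = ∑ t, ∑ u, ψ p q u * M (p, t) (q, u) := by
        rw [Finset.sum_comm]
        simp only [← Finset.mul_sum, col_sum_of_mem_transportPlans hMX hpq.ne]
      rw [hφ, hψ, ← Finset.sum_add_distrib, ← Finset.sum_sub_distrib]
      refine Finset.sum_nonneg fun t _ => ?_
      rw [← Finset.sum_add_distrib, ← Finset.sum_sub_distrib]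
      refine Finset.sum_nonneg fun u _ => ?_
      rw [← add_mul, ← sub_mul]
      exact mul_nonneg (sub_nonneg.mpr (hD.2 p q hpq t u)) (hMX.2.1 p q hpq.ne t u)
    · exact le_rfl
  rw [Matrix.sub_mul, Matrix.trace_sub] at hgap
  linarith

/-- For a fixed positive semidefinite `Y`, the Lagrangian is minimised over transport plans at a
value of the dual objective. -/
theorem exists_transportPlan_dualObj_eq {L : ℕ} {ρ : Fin L → ℝ}
    (hρ : ∀ p, 0 ≤ ρ p ∧ ρ p ≤ 1) {C Y : Matrix (Idx L) (Idx L) ℝ} (hC : C.IsSymm)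
    (hCdiag : ∀ p : Fin L, ∀ t u : Fin 2, C (p, t) (p, u) = 0) (hY : Y.PosSemidef) :
    ∃ M ∈ transportPlans ρ, ∃ φ ψ, DualFeasible C Y φ ψ ∧
      dualObj ρ Y φ ψ = ((C - Y) * M).trace := by
  have hot := fun p q : Fin L => exists_coupling_eq_dual_potentials
    (fun t u => (C - Y) (p, t) (q, u)) (mu1 ρ p) (mu1 ρ q) (mu1_nonneg hρ p) (mu1_nonneg hρ q)
    (by simpa [Fin.sum_univ_two] using sum_mu1 ρ p)
    (by simpa [Fin.sum_univ_two] using sum_mu1 ρ q)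
  choose m φ ψ hm hrow hcol hle heq using hot
  let M : Matrix (Idx L) (Idx L) ℝ := Matrix.of fun i j =>
    if i.1 < j.1 then m i.1 j.1 i.2 j.2 else if j.1 < i.1 then m j.1 i.1 j.2 i.2
    else if i.2 = j.2 then mu1 ρ i.1 i.2 else 0
  have hlt : ∀ p q, p < q → ∀ t u, M (p, t) (q, u) = m p q t u := by
    intro p q h t u
    simp [M, h]
  have hgt : ∀ p q, q < p → ∀ t u, M (p, t) (q, u) = m q p u t := by
    intro p q h t u
    simp [M, h, h.not_gt]
  have hdiag : ∀ p t u, M (p, t) (p, u) = if t = u then mu1 ρ p t else 0 := by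
    intro p t u
    simp [M]
  have hM : M ∈ transportPlans ρ := by
    refine ⟨Matrix.IsSymm.ext ?_, fun p q hpq t u => ?_, fun p q hpq t => ?_, hdiag⟩
    · rintro ⟨p, t⟩ ⟨q, u⟩
      rcases lt_trichotomy p q with h | rfl | h
      · rw [hlt p q h, hgt q p h]
      · rw [hdiag, hdiag]
        rcases eq_or_ne t u with rfl | htu
        · rfl
        · rw [if_neg htu, if_neg htu.symm]
      · rw [hlt q p h, hgt p q h]
    · rcases hpq.lt_or_gt with h | h
      · rw [hlt p q h]
        exact hm p q t u
      · rw [hgt p q h]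
        exact hm q p u t
    · rcases hpq.lt_or_gt with h | h
      · simp only [hlt p q h]
        exact hrow p q t
      · simp only [hgt p q h]
        exact hcol q p t
  refine ⟨M, hM, φ, ψ, ⟨hY, fun p q _ t u => hle p q t u⟩, ?_⟩
  have hgap := trace_sub_mul_sub_dualObj hC hCdiag (isSymm_of_posSemidef hY) hM φ ψ
  have hslack : (∑ p, ∑ q, if p < q then
      (∑ t, ∑ u, (C - Y) (p, t) (q, u) * M (p, t) (q, u)) -
        ((∑ t, φ p q t * mu1 ρ p t) + ∑ u, ψ p q u * mu1 ρ q u) else 0) = 0 := by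
    refine Finset.sum_eq_zero fun p _ => Finset.sum_eq_zero fun q _ => ?_
    split_ifs with hpq
    · simp only [hlt p q hpq]
      exact sub_eq_zero.mpr (heq p q)
    · rfl
  rw [hslack] at hgap
  linarith

/-- The second-moment matrix of independent Bernoulli variables is primal feasible. -/
theorem exists_primalFeasible {L : ℕ} {ρ : Fin L → ℝ} (hρ : ∀ p, 0 ≤ ρ p ∧ ρ p ≤ 1) :
    ∃ M, PrimalFeasible ρ M := by
  let M : Matrix (Idx L) (Idx L) ℝ := Matrix.of fun i j =>
    if i.1 = j.1 then (if i.2 = j.2 then mu1 ρ i.1 i.2 else 0)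
    else mu1 ρ i.1 i.2 * mu1 ρ j.1 j.2
  let v : Idx L → ℝ := fun i => mu1 ρ i.1 i.2
  let w : Fin L → Idx L → ℝ := fun p i => if p = i.1 then (if i.2 = 0 then 1 else -1) else 0
  have hdecomp : M = Matrix.vecMulVec v (star v) +
      ∑ p, (ρ p * (1 - ρ p)) • Matrix.vecMulVec (w p) (star (w p)) := by
    ext ⟨p, t⟩ ⟨q, u⟩
    rcases eq_or_ne p q with rfl | hpq
    · fin_cases t <;> fin_cases u <;>
        simp [M, v, w, mu1, Matrix.sum_apply, Matrix.vecMulVec_apply] <;> ring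
    · simp [M, v, w, hpq, hpq.symm, Matrix.sum_apply, Matrix.vecMulVec_apply]
  have hpsd : M.PosSemidef := by
    rw [hdecomp]
    exact (Matrix.posSemidef_vecMulVec_self_star v).add <| Matrix.posSemidef_sum _ fun p _ =>
      (Matrix.posSemidef_vecMulVec_self_star (w p)).smul
        (mul_nonneg (hρ p).1 (sub_nonneg.mpr (hρ p).2))
  refine ⟨M, hpsd, fun p q hpq t u => ?_, fun p q hpq t => ?_, fun p t u => ?_⟩
  · simpa [M, hpq] using mul_nonneg (mu1_nonneg hρ p t) (mu1_nonneg hρ q u)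
  · simp only [M, Matrix.of_apply, if_neg hpq, ← Finset.mul_sum, sum_mu1, mul_one]
  · simp [M]

/-- Every upper bound of the dual values bounds the cost of some primal feasible point. -/
theorem exists_primalFeasible_trace_le {L : ℕ} {ρ : Fin L → ℝ}
    (hρ : ∀ p, 0 ≤ ρ p ∧ ρ p ≤ 1) {C : Matrix (Idx L) (Idx L) ℝ} (hC : C.IsSymm)
    (hCdiag : ∀ p : Fin L, ∀ t u : Fin 2, C (p, t) (p, u) = 0) {d : ℝ}
    (hd : d ∈ upperBounds (dualValues ρ C)) :
    ∃ M, PrimalFeasible ρ M ∧ (C * M).trace ≤ d := by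
  by_contra! hno
  let T : Matrix (Idx L) (Idx L) ℝ →ₗ[ℝ] Matrix (Idx L) (Idx L) ℝ × ℝ :=
    LinearMap.id.prod (Matrix.traceLinearMap (Idx L) ℝ ℝ ∘ₗ LinearMap.mulLeft ℝ C)
  have hT : ∀ M, T M = (M, (C * M).trace) := fun M => rfl
  have hTc : Continuous T := by
    change Continuous fun M => (M, (C * M).trace)
    fun_prop
  have hpsd : Convex ℝ {A : Matrix (Idx L) (Idx L) ℝ | A.PosSemidef} :=
    fun A hA B hB a b ha hb _ => (hA.smul ha).add (hB.smul hb)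
  have : LocallyConvexSpace ℝ (Matrix (Idx L) (Idx L) ℝ) :=
    inferInstanceAs (LocallyConvexSpace ℝ (Idx L → Idx L → ℝ))
  obtain ⟨f, u, v, hfu, huv, hfv⟩ := geometric_hahn_banach_compact_closed
    ((convex_transportPlans ρ).linear_image T) ((isCompact_transportPlans hρ).image hTc)
    (hpsd.prod (convex_Iic d)) (isClosed_setOf_posSemidef.prod isClosed_Iic) (by
      rw [Set.disjoint_left]
      rintro _ ⟨M, hM, rfl⟩ ⟨hMpsd, hMd⟩
      exact absurd (hno M ⟨hMpsd, hM.2⟩) (not_lt.mpr hMd))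
  let g : Matrix (Idx L) (Idx L) ℝ →ₗ[ℝ] ℝ := f.toLinearMap ∘ₗ LinearMap.inl ℝ _ ℝ
  set s : ℝ := f (0, 1)
  have hf : ∀ M r, f (M, r) = g M + r * s := by
    intro M r
    have : (M, r) = (M, (0 : ℝ)) + r • ((0 : Matrix (Idx L) (Idx L) ℝ), (1 : ℝ)) := by simp
    rw [this, map_add, map_smul, smul_eq_mul]
    rfl
  have hv : ∀ M : Matrix (Idx L) (Idx L) ℝ, M.PosSemidef → ∀ r ≤ d, v < g M + r * s := by
    intro M hM r hr
    rw [← hf]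
    exact hfv _ ⟨hM, hr⟩
  have hu : ∀ M ∈ transportPlans ρ, g M + (C * M).trace * s < u := by
    intro M hM
    rw [← hf, ← hT]
    exact hfu _ ⟨M, hM, rfl⟩
  have hs0 : s ≤ 0 := by
    by_contra! hpos
    have h := hv 0 .zero (min d (v / s)) (min_le_left _ _)
    have h2 : min d (v / s) * s ≤ v / s * s :=
      mul_le_mul_of_nonneg_right (min_le_right _ _) hpos.le
    rw [div_mul_cancel₀ _ hpos.ne'] at h2
    rw [map_zero] at h
    linarith
  have hg : ∀ A : Matrix (Idx L) (Idx L) ℝ, A.PosSemidef → 0 ≤ g A := by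
    intro A hA
    by_contra! hneg
    have hk : 0 ≤ |v - d * s| / (-g A) := div_nonneg (abs_nonneg _) (by linarith)
    have h := hv _ (hA.smul hk) d le_rfl
    have hcancel : |v - d * s| / (-g A) * g A = -|v - d * s| := by
      field_simp [hneg.ne]
    rw [map_smul, smul_eq_mul, hcancel] at h
    linarith [neg_abs_le (v - d * s), le_abs_self (v - d * s)]
  have hv0 : v < d * s := by simpa using hv 0 .zero d le_rfl
  rcases hs0.lt_or_eq with hneg | hzero
  · have hinv : 0 < (-s)⁻¹ := inv_pos.mpr (neg_pos.mpr hneg)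
    obtain ⟨Y, hY, hgY⟩ := exists_posSemidef_trace_mul_eq ((-s)⁻¹ • g)
      fun A hA => mul_nonneg hinv.le (hg A hA)
    obtain ⟨M, hM, φ, ψ, hD, heq⟩ := exists_transportPlan_dualObj_eq hρ hC hCdiag hY
    have hle : dualObj ρ Y φ ψ ≤ d := hd ⟨Y, φ, ψ, hD, rfl⟩
    have hgM : g M = -s * (Y * M).trace := by
      rw [← hgY M hM.1, LinearMap.smul_apply, smul_eq_mul,
        mul_inv_cancel_left₀ (neg_pos.mpr hneg).ne']
    rw [heq, Matrix.sub_mul, Matrix.trace_sub] at hle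
    have hlt := hu M hM
    rw [hgM] at hlt
    nlinarith
  · obtain ⟨M, hM⟩ := exists_primalFeasible hρ
    have hlt := hu M hM.mem_transportPlans
    rw [hzero, mul_zero] at hlt hv0
    linarith [hg M hM.1]

/-- Strong duality (Lemma 3.1): the primal optimal value is finite and equals the
supremum of the dual objective over dual feasible points (zero duality gap). -/
theorem strong_duality (L : ℕ) (hL : 2 ≤ L) (ρ : Fin L → ℝ)
    (hρ : ∀ p, 0 ≤ ρ p ∧ ρ p ≤ 1)
    (C : Matrix (Idx L) (Idx L) ℝ) (hCsymm : C.IsSymm)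
    (hCdiag : ∀ p : Fin L, ∀ t u : Fin 2, C (p, t) (p, u) = 0) :
    ∃ E : ℝ, IsGLB (primalValues ρ C) E ∧ IsLUB (dualValues ρ C) E := by
  obtain ⟨M₀, hM₀⟩ := exists_primalFeasible hρ
  have hweak : ∀ M, PrimalFeasible ρ M → (C * M).trace ∈ upperBounds (dualValues ρ C) := by
    rintro M hM _ ⟨Y, φ, ψ, hD, rfl⟩
    exact dualObj_le_trace hCsymm hCdiag hD hM
  have hne : (dualValues ρ C).Nonempty := by
    obtain ⟨-, -, φ, ψ, hD, -⟩ :=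
      exists_transportPlan_dualObj_eq hρ hCsymm hCdiag Matrix.PosSemidef.zero
    exact ⟨_, 0, φ, ψ, hD, rfl⟩
  have hlub := isLUB_csSup hne ⟨_, hweak M₀ hM₀⟩
  obtain ⟨M, hM, hle⟩ := exists_primalFeasible_trace_le hρ hCsymm hCdiag hlub.1
  refine ⟨_, ⟨?_, fun b hb => (hb ⟨M, hM, rfl⟩).trans hle⟩, hlub⟩
  rintro _ ⟨N, hN, rfl⟩
  exact hlub.2 (hweak N hN)
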